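/- Let γ = (γ_n)_{n≥1} be a complex sequence, b_n := ∑_{d∣n} γ_d, and assume both γ and b are eventually linearly recurrent. Then γ_p = 0 and b_p = γ_1 for all sufficiently large primes p. In particular, if γ_1 = 0, then γ_p = 0 and b_p = 0 for all sufficiently large primes p. -/

import Mathlib

/-- A complex sequence `u` is *eventually linearly recurrent* if there exist `r ≥ 1`,
coefficients `c 0, …, c (r-1)` with trailing coefficient `c 0 ≠ 0`, and an index `N`
such that `u (n + r) = ∑ i < r, c i * u (n + i)` for all `n ≥ N`. -/
def EventuallyLinRec (u : ℕ → ℂ) : Prop :=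
  ∃ (r : ℕ) (c : ℕ → ℂ) (N : ℕ), 1 ≤ r ∧ c 0 ≠ 0 ∧
    ∀ n, N ≤ n → u (n + r) = ∑ i ∈ Finset.range r, c i * u (n + i)

open Polynomial in
/-- The shift operator on sequences. -/
def shiftE (R : Type*) [CommRing R] : Module.End R (ℕ → R) where
  toFun g := fun n => g (n + 1)
  map_add' _ _ := rfl
  map_smul' _ _ := rfl

theorem shiftE_pow {R : Type*} [CommRing R] (g : ℕ → R) (k n : ℕ) :
    ((shiftE R) ^ k) g n = g (n + k) := by
  induction k generalizing n with
  | zero => simp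
  | succ k ih =>
    rw [pow_succ', Module.End.mul_apply]
    change ((shiftE R) ^ k) g (n + 1) = _
    rw [ih]; congr 1; ring

open Polynomial in
theorem aeval_shift_apply {R : Type*} [CommRing R] (P : R[X]) (g : ℕ → R) (n : ℕ) :
    (aeval (shiftE R) P) g n = ∑ i ∈ Finset.range (P.natDegree + 1), P.coeff i * g (n + i) := by
  rw [aeval_eq_sum_range]
  simp [LinearMap.sum_apply, Finset.sum_apply, shiftE_pow]

open Polynomial in
theorem poly_of_rec {R : Type*} [CommRing R] (g : ℕ → R) (r : ℕ) (hr : 1 ≤ r) (c : ℕ → R)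
    (h : ∀ n, g (n + r) = ∑ i ∈ Finset.range r, c i * g (n + i)) :
    ∃ P : R[X], P.Monic ∧ P.coeff 0 = - c 0 ∧ aeval (shiftE R) P g = 0 := by
  refine ⟨X ^ r - ∑ i : Fin r, C (c i) * X ^ (i : ℕ), ?_, ?_, ?_⟩
  · exact monic_X_pow_sub (degree_sum_fin_lt _)
  · rw [Fin.sum_univ_eq_sum_range (fun i => C (c i) * X ^ i) r]
    simp only [coeff_sub, coeff_X_pow, finsetSum_coeff, coeff_C_mul]
    rw [if_neg (by omega)]
    simp [Finset.sum_ite_eq]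
    omega
  · funext n
    rw [Fin.sum_univ_eq_sum_range (fun i => C (c i) * X ^ i) r]
    simp [LinearMap.sum_apply, Finset.sum_apply, shiftE_pow, h, ← Algebra.smul_def]

open Polynomial in
theorem aeval_shift_mem {R : Type*} [CommRing R] (I : Ideal R) (Q : R[X])
    (hQ : Q ∈ I.map (C : R →+* R[X])) (g : ℕ → R) (n : ℕ) :
    (aeval (shiftE R) Q) g n ∈ I := by
  rw [aeval_shift_apply]
  exact Ideal.sum_mem _ fun i _ => Ideal.mul_mem_right _ _ (Ideal.mem_map_C_iff.1 hQ i)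

theorem sup_pow_le' {R : Type*} [CommRing R] (A B : Ideal R) (k : ℕ) :
    (A ⊔ B) ^ k ≤ A ⊔ B ^ k := by
  induction k with
  | zero => simp
  | succ k ih =>
    rw [pow_succ (A ⊔ B) k, pow_succ B k]
    refine le_trans (Ideal.mul_mono ih (le_refl (A ⊔ B))) ?_
    rw [Ideal.sup_mul, Ideal.mul_sup (B ^ k)]
    refine sup_le ?_ (sup_le ?_ ?_)
    · exact le_trans (Ideal.mul_le_left (I := A) (J := A ⊔ B)) le_sup_left
    · exact le_trans (Ideal.mul_le_right (I := B ^ k) (J := A)) le_sup_left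
    · exact le_sup_right

theorem pow_sub_one_mem {S : Type*} [CommRing S] (I : Ideal S) (x : S) (M : ℕ)
    (hM : (M : S) ∈ I) (hx : x ^ M - 1 ∈ I) (k : ℕ) : x ^ (M ^ k) - 1 ∈ I ^ k := by
  induction k with
  | zero => simp
  | succ k ih =>
    rcases Nat.eq_zero_or_pos k with rfl | hk
    · simpa using hx
    set y := x ^ (M ^ k) with hy
    have h1 : x ^ (M ^ (k + 1)) - 1 = (y - 1) * ∑ i ∈ Finset.range M, y ^ i := by
      rw [mul_geom_sum, hy, ← pow_mul, pow_succ]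
    rw [h1, pow_succ]
    refine Ideal.mul_mem_mul ih ?_
    have hy1 : y - 1 ∈ I := Ideal.pow_le_self hk.ne' ih
    have hq : Ideal.Quotient.mk I y = 1 := by
      rw [← map_one (Ideal.Quotient.mk I)]; exact Ideal.Quotient.eq.2 hy1
    rw [← Ideal.Quotient.eq_zero_iff_mem] at hM ⊢
    simpa [hq] using hM

theorem isJacobsonRing_int : IsJacobsonRing ℤ := by
  rw [isJacobsonRing_iff_prime_eq]
  intro P hP
  by_cases h : P = ⊥
  · subst h
    refine le_antisymm ?_ Ideal.le_jacobson
    intro x hx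
    have h1 := Ideal.mem_jacobson_bot.1 hx x
    have hx0 : x = 0 := by
      rcases Int.isUnit_iff.1 h1 with h | h
      · simpa using h
      · nlinarith
    simpa using hx0
  · have := hP.isMaximal h
    exact Ideal.jacobson_eq_self_of_isMaximal

theorem finite_field_of_fg {R : Type*} [CommRing R] [Algebra.FiniteType ℤ R]
    (K : Type*) [Field K] (f : R →+* K) (hsurj : Function.Surjective f) : Finite K := by
  have hft : Algebra.FiniteType ℤ K := Algebra.FiniteType.of_surjective f.toIntAlgHom hsurj
  have := isJacobsonRing_int
  have hf : Module.Finite ℤ K := finite_of_finite_type_of_isJacobsonRing ℤ K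
  have hinj : ¬ Function.Injective (algebraMap ℤ K) := by
    intro hinj
    have := isField_of_isIntegral_of_isField hinj (Field.toIsField K)
    exact Int.not_isField this
  obtain ⟨a, ha, ha0⟩ : ∃ a : ℤ, algebraMap ℤ K a = 0 ∧ a ≠ 0 := by
    by_contra! h
    exact hinj ((injective_iff_map_eq_zero _).2 h)
  refine Module.finite_of_fg_torsion K ?_
  intro x
  refine ⟨⟨a, mem_nonZeroDivisors_of_ne_zero ha0⟩, ?_⟩
  change a • x = 0
  rw [Algebra.smul_def, ha, zero_mul]

open Polynomial in
theorem main_ring {R : Type*} [CommRing R] [IsDomain R] [Algebra.FiniteType ℤ R]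
    (g : ℕ → R) (P : R[X]) (hP : P.Monic) (h0 : IsUnit (P.coeff 0))
    (hg : aeval (shiftE R) P g = 0) :
    ∃ M : ℕ, 0 < M ∧ ∀ n, (∀ k, ∃ m, g (n + M ^ k * m) = 0) → g n = 0 := by
  have : IsNoetherianRing R := Algebra.FiniteType.isNoetherianRing ℤ R
  obtain ⟨𝔪, h𝔪⟩ := Ideal.exists_maximal R
  let : Field (R ⧸ 𝔪) := Ideal.Quotient.field 𝔪
  have hK : Finite (R ⧸ 𝔪) := finite_field_of_fg _ (Ideal.Quotient.mk 𝔪) Ideal.Quotient.mk_surjective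
  set π := Ideal.Quotient.mk 𝔪 with hπ
  have hPm : (P.map π).Monic := hP.map π
  have hfin : Module.Finite (R ⧸ 𝔪) (AdjoinRoot (P.map π)) := hPm.finite_adjoinRoot
  have hfinS : Finite (AdjoinRoot (P.map π)) := Module.finite_of_finite (R ⧸ 𝔪)
  have hu : IsUnit (AdjoinRoot.root (P.map π)) := by
    have h1 : AdjoinRoot.mk (P.map π) (P.map π) = 0 := AdjoinRoot.mk_self
    have h3 : AdjoinRoot.mk (P.map π) (X * (P.map π).divX + C ((P.map π).coeff 0)) = 0 := by
      rw [X_mul_divX_add]; exact h1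
    rw [map_add, map_mul] at h3
    have h2 : IsUnit (AdjoinRoot.mk (P.map π) (C ((P.map π).coeff 0))) := by
      rw [coeff_map]
      exact ((h0.map π).map C).map _
    refine isUnit_of_mul_isUnit_left (y := AdjoinRoot.mk _ (P.map π).divX) ?_
    rw [← AdjoinRoot.mk_X, eq_neg_of_add_eq_zero_left h3]
    exact h2.neg
  obtain ⟨T, hT, hT1⟩ : ∃ T : ℕ, 0 < T ∧ (AdjoinRoot.root (P.map π)) ^ T = 1 := by
    obtain ⟨u, hu⟩ := hu
    refine ⟨orderOf u, orderOf_pos u, ?_⟩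
    rw [← hu, ← Units.val_pow_eq_pow_val, pow_orderOf_eq_one, Units.val_one]
  set L := Nat.card (R ⧸ 𝔪) with hL
  have hLpos : 0 < L := Nat.card_pos
  set I : Ideal R[X] := Ideal.span {P} ⊔ 𝔪.map C with hI
  have hXT : (X : R[X]) ^ T - 1 ∈ I := by
    have hd : P.map π ∣ X ^ T - 1 := by
      rw [← AdjoinRoot.mk_eq_zero]
      simp [hT1]
    obtain ⟨q, hq⟩ := hd
    obtain ⟨Q, rfl⟩ := Polynomial.map_surjective π Ideal.Quotient.mk_surjective q
    have he : X ^ T - 1 - P * Q ∈ 𝔪.map (C : R →+* R[X]) := by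
      rw [Ideal.mem_map_C_iff]
      intro n
      rw [← Ideal.Quotient.eq_zero_iff_mem, ← hπ, ← coeff_map]
      simp [hq]
    have : (X : R[X]) ^ T - 1 = P * Q + (X ^ T - 1 - P * Q) := by ring
    rw [this]
    exact Ideal.add_mem _ (Ideal.mem_sup_left (Ideal.mul_mem_right _ _ (Ideal.mem_span_singleton_self P)))
      (Ideal.mem_sup_right he)
  have hLm : (L : R) ∈ 𝔪 := by
    rw [← Ideal.Quotient.eq_zero_iff_mem, map_natCast, hL]
    have := Fintype.ofFinite (R ⧸ 𝔪)
    rw [Nat.card_eq_fintype_card]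
    exact Nat.cast_card_eq_zero _
  refine ⟨T * L, Nat.mul_pos hT hLpos, ?_⟩
  have hMI : ((T * L : ℕ) : R[X]) ∈ I := by
    rw [Nat.cast_mul]
    refine Ideal.mul_mem_left _ _ (Ideal.mem_sup_right ?_)
    have := Ideal.mem_map_of_mem (C : R →+* R[X]) hLm
    simpa using this
  have hXM : (X : R[X]) ^ (T * L) - 1 ∈ I := by
    rw [pow_mul]
    have h1 : (X ^ T - 1 : R[X]) ∣ (X ^ T) ^ L - 1 := by
      simpa using sub_dvd_pow_sub_pow (X ^ T : R[X]) 1 L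
    exact Ideal.mem_of_dvd _ h1 hXT
  intro n hn
  have hmem : ∀ k, g n ∈ 𝔪 ^ k := by
    intro k
    obtain ⟨m, hm⟩ := hn k
    have h1 : (X : R[X]) ^ ((T * L) ^ k * m) - 1 ∈ Ideal.span {P} ⊔ (𝔪.map C) ^ k := by
      refine sup_pow_le' _ _ _ ?_
      have h2 := pow_sub_one_mem I X (T * L) hMI hXM k
      refine Ideal.mem_of_dvd _ ?_ h2
      rw [pow_mul]
      simpa using sub_dvd_pow_sub_pow (X ^ ((T * L) ^ k) : R[X]) 1 m
    rw [← Ideal.map_pow] at h1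
    obtain ⟨a, ha, e, he, hae⟩ := Submodule.mem_sup.1 h1
    obtain ⟨Q, rfl⟩ := Ideal.mem_span_singleton'.1 ha
    have h3 : (aeval (shiftE R) ((X : R[X]) ^ ((T * L) ^ k * m) - 1)) g n = - g n := by
      rw [map_sub, map_pow, aeval_X, map_one, LinearMap.sub_apply, Pi.sub_apply, shiftE_pow, hm]
      simp
    rw [← hae, map_add, map_mul, LinearMap.add_apply, Module.End.mul_apply, hg, map_zero,
      zero_add] at h3
    have h4 := aeval_shift_mem _ _ he g n
    rw [h3] at h4
    simpa using h4
  have hbot := Ideal.iInf_pow_eq_bot_of_isDomain 𝔪 h𝔪.ne_top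
  have : g n ∈ (⨅ i : ℕ, 𝔪 ^ i) := by simpa [Submodule.mem_iInf] using hmem
  rw [hbot] at this
  simpa using this

open Polynomial in
theorem main_complex (g : ℕ → ℂ) (P : ℂ[X]) (hP : P.Monic) (h0 : P.coeff 0 ≠ 0)
    (hd : 1 ≤ P.natDegree) (hg : aeval (shiftE ℂ) P g = 0) :
    ∃ M : ℕ, 0 < M ∧ ∀ n, (∀ k, ∃ m, g (n + M ^ k * m) = 0) → g n = 0 := by
  classical
  set r := P.natDegree with hr
  set s : Set ℂ := insert (P.coeff 0)⁻¹
    ((fun i => P.coeff i) '' Set.Iio r ∪ g '' Set.Iio r) with hs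
  have hsf : s.Finite := by
    refine Set.Finite.insert _ (Set.Finite.union ?_ ?_) <;> exact (Set.finite_Iio r).image _
  set R := Algebra.adjoin ℤ s with hR
  have hft : Algebra.FiniteType ℤ R := Algebra.FiniteType.adjoin_of_finite hsf
  have hsub : s ⊆ R := Algebra.subset_adjoin
  have hc : ∀ i < r, P.coeff i ∈ R := fun i hi =>
    hsub (Or.inr (Or.inl ⟨i, hi, rfl⟩))
  have hi : (P.coeff 0)⁻¹ ∈ R := hsub (Or.inl rfl)
  have hrec : ∀ n, g (n + r) = ∑ i ∈ Finset.range r, (- P.coeff i) * g (n + i) := by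
    intro n
    have h1 := congrFun hg n
    rw [aeval_shift_apply, Finset.sum_range_succ, hP.coeff_natDegree, one_mul, Pi.zero_apply] at h1
    rw [eq_neg_of_add_eq_zero_right h1]
    simp [hr]
  have hgR : ∀ n, g n ∈ R := by
    intro n
    induction n using Nat.strong_induction_on with
    | _ n ih =>
      rcases lt_or_ge n r with h | h
      · exact hsub (Or.inr (Or.inr ⟨n, h, rfl⟩))
      · obtain ⟨m, rfl⟩ := Nat.exists_eq_add_of_le' h
        rw [hrec]
        refine sum_mem fun i hi => ?_
        have hi := Finset.mem_range.1 hi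
        exact mul_mem (neg_mem (hc i hi)) (ih _ (by omega))
  let g' : ℕ → R := fun n => ⟨g n, hgR n⟩
  let c : ℕ → R := fun i => if h : i < r then ⟨- P.coeff i, neg_mem (hc i h)⟩ else 0
  obtain ⟨P', hP', h0', hg'⟩ := poly_of_rec g' r hd c (by
    intro n
    apply Subtype.ext
    push_cast
    change g (n + r) = _
    rw [hrec]
    refine Finset.sum_congr rfl fun i hi => ?_
    have hi := Finset.mem_range.1 hi
    simp [c, hi, g'])
  have hu : IsUnit (P'.coeff 0) := by
    rw [h0', isUnit_iff_exists_inv]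
    refine ⟨⟨_, hi⟩, ?_⟩
    apply Subtype.ext
    have : 0 < r := hd
    simp [c, this, h0]
  obtain ⟨M, hM, H⟩ := main_ring g' P' hP' hu hg'
  refine ⟨M, hM, fun n hn => ?_⟩
  have := H n (fun k => by
    obtain ⟨m, hm⟩ := hn k
    exact ⟨m, Subtype.ext hm⟩)
  exact congrArg Subtype.val this

open Polynomial in
theorem eventually_poly (u : ℕ → ℂ) (h : EventuallyLinRec u) :
    ∃ N, ∀ N' ≥ N, ∃ P : ℂ[X], P.Monic ∧ P.coeff 0 ≠ 0 ∧
      aeval (shiftE ℂ) P (fun n => u (n + N')) = 0 := by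
  obtain ⟨r, c, N, hr, hc, h⟩ := h
  refine ⟨N, fun N' hN' => ?_⟩
  obtain ⟨P, h1, h2, h3⟩ := poly_of_rec (fun n => u (n + N')) r hr c (by
    intro n
    have := h (n + N') (by omega)
    simp only [add_right_comm _ _ N']
    exact this)
  exact ⟨P, h1, by simpa [h2] using hc, h3⟩

open Polynomial in
theorem exists_modulus (γ b : ℕ → ℂ)
    (hb : ∀ n, 1 ≤ n → b n = ∑ d ∈ n.divisors, γ d)
    (hγrec : EventuallyLinRec γ) (hbrec : EventuallyLinRec b) :
    ∃ N M : ℕ, 0 < M ∧ ∀ n ≥ N, n.Coprime M → b n = γ n + γ 1 := by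
  obtain ⟨N₁, h₁⟩ := eventually_poly γ hγrec
  obtain ⟨N₂, h₂⟩ := eventually_poly b hbrec
  set N := max N₁ N₂
  obtain ⟨P, hP, hP0, hPg⟩ := h₁ N (le_max_left _ _)
  obtain ⟨Q, hQ, hQ0, hQg⟩ := h₂ N (le_max_right _ _)
  set g₁ : ℕ → ℂ := fun n => γ (n + N)
  set g₂ : ℕ → ℂ := fun n => b (n + N)
  set g₃ : ℕ → ℂ := fun _ => γ 1
  have h₃ : aeval (shiftE ℂ) (X - C 1 : ℂ[X]) g₃ = 0 := by
    funext n
    simp only [map_sub, aeval_X, map_one, LinearMap.sub_apply, Pi.sub_apply]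
    simp [shiftE, g₃]
  have hm : ((X - C 1) * (P * Q) : ℂ[X]).Monic := (monic_X_sub_C 1).mul (hP.mul hQ)
  obtain ⟨M, hM, H⟩ := main_complex (g₂ - g₁ - g₃) ((X - C 1) * (P * Q)) hm
    (by simp [mul_coeff_zero, hP0, hQ0])
    (by rw [(monic_X_sub_C (1:ℂ)).natDegree_mul (hP.mul hQ), natDegree_X_sub_C]; omega)
    (by
      have e1 : aeval (shiftE ℂ) ((X - C 1) * (P * Q)) g₁ = 0 := by
        rw [show (X - C 1) * (P * Q) = ((X - C 1) * Q) * P by ring, map_mul,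
          Module.End.mul_apply, hPg, map_zero]
      have e2 : aeval (shiftE ℂ) ((X - C 1) * (P * Q)) g₂ = 0 := by
        rw [show (X - C 1) * (P * Q) = ((X - C 1) * P) * Q by ring, map_mul,
          Module.End.mul_apply, hQg, map_zero]
      have e3 : aeval (shiftE ℂ) ((X - C 1) * (P * Q)) g₃ = 0 := by
        rw [show (X - C 1) * (P * Q) = (P * Q) * (X - C 1) by ring, map_mul,
          Module.End.mul_apply, h₃, map_zero]
      rw [map_sub, map_sub, e1, e2, e3]; simp)
  refine ⟨N, M, hM, fun n hn hcop => ?_⟩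
  obtain ⟨j, rfl⟩ := Nat.exists_eq_add_of_le' hn
  have := H j (fun k => by
    obtain ⟨p, hpn, hpp, hmod⟩ := Nat.forall_exists_prime_gt_and_modEq (j + N) (q := M ^ k)
      (a := j + N) (pow_pos hM k).ne' (Nat.Coprime.pow_right k hcop)
    obtain ⟨m, hm⟩ := (Nat.modEq_iff_dvd' hpn.le).1 hmod.symm
    refine ⟨m, ?_⟩
    have hpe : j + M ^ k * m + N = p := by omega
    simp only [Pi.sub_apply, g₁, g₂, g₃, hpe]
    rw [hb p hpp.one_lt.le, hpp.sum_divisors]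
    ring)
  simp only [Pi.sub_apply, g₁, g₂, g₃] at this
  linear_combination this

open scoped Pointwise in
theorem pair_zero (γ b : ℕ → ℂ)
    (hb : ∀ n, 1 ≤ n → b n = ∑ d ∈ n.divisors, γ d) (N M : ℕ) (hM : 0 < M)
    (h : ∀ n ≥ N, n.Coprime M → b n = γ n + γ 1) (p q : ℕ) (hp : p.Prime) (hq : q.Prime)
    (hpN : N + M < p) (hpq : p < q) : γ p + γ q = 0 := by
  have hcop : ∀ x, x.Prime → M < x → x.Coprime M := fun x hx hxM =>
    (Nat.Prime.coprime_iff_not_dvd hx).2 fun hd => absurd (Nat.le_of_dvd hM hd) (by omega)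
  have hpq' : p.Coprime q := (Nat.coprime_primes hp hq).2 hpq.ne
  have h1 := h (p * q) (by nlinarith [hq.pos])
    (Nat.Coprime.mul_left (hcop p hp (by omega)) (hcop q hq (by omega)))
  have hdiv : (p * q).divisors = {1, p, q, p * q} := by
    rw [Nat.divisors_mul, hp.divisors, hq.divisors]
    ext x
    simp only [Finset.mem_mul, Finset.mem_insert, Finset.mem_singleton]
    constructor
    · rintro ⟨y, rfl | rfl, z, rfl | rfl, rfl⟩ <;> simp
    · rintro (rfl | rfl | rfl | rfl)
      · exact ⟨1, by simp, 1, by simp, by simp⟩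
      · exact ⟨x, by simp, 1, by simp, by simp⟩
      · exact ⟨1, by simp, x, by simp, by simp⟩
      · exact ⟨p, by simp, q, by simp, by simp⟩
  have hp1 := hp.one_lt
  have hq1 := hq.one_lt
  have hppq : p < p * q := by nlinarith
  have hqpq : q < p * q := by nlinarith
  rw [hb _ (Nat.mul_pos hp.pos hq.pos), hdiv, Finset.sum_insert, Finset.sum_insert,
    Finset.sum_insert, Finset.sum_singleton] at h1
  · linear_combination h1
  · simp only [Finset.mem_singleton]; omega
  · simp only [Finset.mem_insert, Finset.mem_singleton]; omega
  · simp only [Finset.mem_insert, Finset.mem_singleton]; omega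

/-- If `γ` and its divisor-sum sequence `b` are eventually linearly recurrent, then
`γ p = 0` and `b p = γ 1` for all sufficiently large primes `p`; in particular, if
`γ 1 = 0` then both `γ p` and `b p` vanish for all sufficiently large primes `p`. -/
theorem stmt_15 (γ b : ℕ → ℂ)
    (hb : ∀ n, 1 ≤ n → b n = ∑ d ∈ n.divisors, γ d)
    (hγrec : EventuallyLinRec γ) (hbrec : EventuallyLinRec b) :
    (∃ N : ℕ, ∀ p : ℕ, Nat.Prime p → N ≤ p → γ p = 0 ∧ b p = γ 1) ∧
    (γ 1 = 0 → ∃ N : ℕ, ∀ p : ℕ, Nat.Prime p → N ≤ p → γ p = 0 ∧ b p = 0) := by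
  obtain ⟨N, M, hM, h⟩ := exists_modulus γ b hb hγrec hbrec
  have key : ∃ N : ℕ, ∀ p : ℕ, Nat.Prime p → N ≤ p → γ p = 0 ∧ b p = γ 1 := by
    refine ⟨N + M + 1, fun p hp hpN => ?_⟩
    obtain ⟨q, hpq, hq⟩ := Nat.exists_infinite_primes (p + 1)
    obtain ⟨r, hqr, hr⟩ := Nat.exists_infinite_primes (q + 1)
    have e1 := pair_zero γ b hb N M hM h p q hp hq (by omega) (by omega)
    have e2 := pair_zero γ b hb N M hM h p r hp hr (by omega) (by omega)
    have e3 := pair_zero γ b hb N M hM h q r hq hr (by omega) (by omega)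
    have hz : γ p = 0 := by linear_combination (e1 + e2 - e3) / 2
    refine ⟨hz, ?_⟩
    rw [hb p hp.one_lt.le, hp.sum_divisors, hz, zero_add]
  refine ⟨key, fun h1 => ?_⟩
  rw [h1] at key
  exact key
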